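/- Theorem 2 (adaptive protocol with imperfect match): (i) The i.i.d. state ρ = (|G⟩⟨G|)^{⊗(N+1)} passes the N-random sampling test of Ω_h(𝒜) with acceptance probability at least (1 − sin²(π/(4h)))^{N · max_{1≤l≤m}|A_l|}. (ii) Assume β ≥ 1/(N+1). For every state ρ on ((ℂ²)^{⊗n})^{⊗(N+1)} whose acceptance probability p for the N-random sampling test of Ω_h(𝒜) satisfies p ≥ β, the conditional state σ of the remaining copy satisfies ⟨G|σ|G⟩ ≥ 1 − [m(1−β)/(βN) + n sin(π/(4h))]. -/

import Mathlib

open scoped BigOperators ComplexOrder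
open Matrix Complex

noncomputable section

/-- Computational-basis index set of `(ℂ²)^{⊗n}`. -/
abbrev QIdx (n : ℕ) := Fin n → Fin 2

/-- Linear operators on `(ℂ²)^{⊗n}`, represented as matrices. -/
abbrev QOp (n : ℕ) := Matrix (QIdx n) (QIdx n) ℂ

/-- A bit viewed as a real number. -/
def bR (b : Fin 2) : ℝ := (b : ℕ)

/-- The ℓ²→ℓ² operator norm of a matrix. -/
noncomputable def opNorm {ι : Type*} [Fintype ι] [DecidableEq ι] (M : Matrix ι ι ℂ) : ℝ :=
  ‖Matrix.toEuclideanCLM (𝕜 := ℂ) M‖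

/-- The weighted graph state `|G⟩`, as amplitudes
`⟨z|G⟩ = 2^{-n/2} ∏_{j<k} e^{i θ_{jk} z_j z_k}` (for symmetric `θ`,
`∑_{j<k} = (1/2) ∑_{j,k}`). -/
noncomputable def gVec (n : ℕ) (θ : Fin n → Fin n → ℝ) : QIdx n → ℂ :=
  fun z => ((Real.sqrt (2 ^ n))⁻¹ : ℝ) *
    Complex.exp (Complex.I * ((1 / 2 * ∑ j, ∑ k, θ j k * bR (z j) * bR (z k) : ℝ) : ℂ))

/-- The rank-one projection `|G⟩⟨G|`. -/
noncomputable def gProj (n : ℕ) (θ : Fin n → Fin n → ℝ) : QOp n :=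
  Matrix.vecMulVec (gVec n θ) (star (gVec n θ))

/-- `α_k(z) = ∑_{j ∈ C_k} θ_{jk} z_j` (using `θ_{jk} = 0` on non-edges). -/
noncomputable def alphaAngle (n : ℕ) (θ : Fin n → Fin n → ℝ) (k : Fin n) (z : QIdx n) : ℝ :=
  ∑ j, θ j k * bR (z j)

/-- The discretization `α ↦ α^h`, the unique point `jπ/h` with
`jπ/h - π/(2h) ≤ α < jπ/h + π/(2h)`. -/
noncomputable def alphaH (h : ℕ) (α : ℝ) : ℝ :=
  (⌊(h : ℝ) * α / Real.pi + 1 / 2⌋ : ℤ) * Real.pi / h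

/-- Matrix entry `⟨b|α⟩⟨α|b'⟩ = (1/2) e^{iα(b-b')}` of the projection onto
`|α⟩ = (|0⟩ + e^{iα}|1⟩)/√2`. -/
noncomputable def phaseFac (α : ℝ) (b b' : Fin 2) : ℂ :=
  (1 / 2 : ℂ) * Complex.exp (Complex.I * ((α * (bR b - bR b') : ℝ) : ℂ))

/-- The projection `P_l = ∏_{k ∈ A_l} Q_k`, written out entrywise:
`P_l = ∑_z (⊗_{k∈A_l} |α_k(z)⟩⟨α_k(z)|) ⊗ |z⟩⟨z|_{A_l^c}`. -/
noncomputable def Pop (n : ℕ) (θ : Fin n → Fin n → ℝ) (A : Finset (Fin n)) : QOp n :=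
  Matrix.of fun x y =>
    if ∀ j ∉ A, x j = y j then ∏ k ∈ A, phaseFac (alphaAngle n θ k x) (x k) (y k) else 0

/-- The test operator `Ω(𝒜) = (1/m) ∑_l P_l`. -/
noncomputable def OmegaA (n m : ℕ) (θ : Fin n → Fin n → ℝ) (A : Fin m → Finset (Fin n)) :
    QOp n :=
  (m : ℂ)⁻¹ • ∑ l, Pop n θ (A l)

/-- The discretized projection `P_{l;h}` (replace `α_k(z)` by `α_k^h(z)`). -/
noncomputable def PopH (n : ℕ) (θ : Fin n → Fin n → ℝ) (h : ℕ) (A : Finset (Fin n)) : QOp n :=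
  Matrix.of fun x y =>
    if ∀ j ∉ A, x j = y j then
      ∏ k ∈ A, phaseFac (alphaH h (alphaAngle n θ k x)) (x k) (y k) else 0

/-- The discretized test operator `Ω_h(𝒜) = (1/m) ∑_l P_{l;h}`. -/
noncomputable def OmegaAH (n m : ℕ) (θ : Fin n → Fin n → ℝ) (h : ℕ)
    (A : Fin m → Finset (Fin n)) : QOp n :=
  (m : ℂ)⁻¹ • ∑ l, PopH n θ h (A l)

/-- Entry of the single-site operator `(1/h) |α⟩⟨α| + (1 - 1/h) I`. -/
noncomputable def mixFac (h : ℕ) (α : ℝ) (b b' : Fin 2) : ℂ :=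
  (1 - (h : ℂ)⁻¹) * (if b = b' then 1 else 0) + (h : ℂ)⁻¹ * phaseFac α b b'

/-- `P̄_l = ∏_{k ∈ A_l} ((1/h(k)) Q_k + (1 - 1/h(k)) I)`, written out entrywise. -/
noncomputable def PBar (n : ℕ) (θ : Fin n → Fin n → ℝ) (hf : Fin n → ℕ) (A : Finset (Fin n)) :
    QOp n :=
  Matrix.of fun x y =>
    if ∀ j ∉ A, x j = y j then ∏ k ∈ A, mixFac (hf k) (alphaAngle n θ k x) (x k) (y k) else 0

/-- `Ω̄(𝒜)_𝐡 = (1/m) ∑_l P̄_l`. -/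
noncomputable def OmegaBar (n m : ℕ) (θ : Fin n → Fin n → ℝ) (hf : Fin n → ℕ)
    (A : Fin m → Finset (Fin n)) : QOp n :=
  (m : ℂ)⁻¹ • ∑ l, PBar n θ hf (A l)

/-- `P̄_{l;h} = ∏_{k ∈ A_l} ((1/h) Q_{k;h} + (1 - 1/h) I)`, written out entrywise. -/
noncomputable def PBarH (n : ℕ) (θ : Fin n → Fin n → ℝ) (h : ℕ) (A : Finset (Fin n)) : QOp n :=
  Matrix.of fun x y =>
    if ∀ j ∉ A, x j = y j then
      ∏ k ∈ A, mixFac h (alphaH h (alphaAngle n θ k x)) (x k) (y k) else 0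

/-- `Ω̄_h(𝒜) = (1/m) ∑_l P̄_{l;h}`. -/
noncomputable def OmegaBarH (n m : ℕ) (θ : Fin n → Fin n → ℝ) (h : ℕ)
    (A : Fin m → Finset (Fin n)) : QOp n :=
  (m : ℂ)⁻¹ • ∑ l, PBarH n θ h (A l)

/-- Index set for `N+1` copies of the `n`-qubit space. -/
abbrev BIdx (n N : ℕ) := Fin (N + 1) → QIdx n

/-- `(⊗_{j ≠ i} Ω) ⊗ I_i` acting on the `N+1` copies. -/
noncomputable def testAll (n N : ℕ) (Ω : QOp n) (i : Fin (N + 1)) :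
    Matrix (BIdx n N) (BIdx n N) ℂ :=
  Matrix.of fun x y =>
    (if x i = y i then 1 else 0) * ∏ j ∈ Finset.univ.erase i, Ω (x j) (y j)

/-- Acceptance probability `p = (1/(N+1)) ∑_i Tr[((⊗_{j≠i} Ω) ⊗ I_i) ρ]` of the
`N`-random sampling test of `Ω` on a state `ρ` of `N+1` copies. -/
noncomputable def acceptProb (n N : ℕ) (Ω : QOp n) (ρ : Matrix (BIdx n N) (BIdx n N) ℂ) : ℝ :=
  (((N : ℂ) + 1)⁻¹ * ∑ i, (testAll n N Ω i * ρ).trace).re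

/-- Partial trace over all copies except copy `i`. -/
noncomputable def ptraceAt (n N : ℕ) (i : Fin (N + 1))
    (M : Matrix (BIdx n N) (BIdx n N) ℂ) : QOp n :=
  Matrix.of fun a b => ∑ x : BIdx n N, if x i = a then M x (Function.update x i b) else 0

/-- The conditional state of the remaining copy given that the test is passed:
`σ = (1/((N+1)p)) ∑_i Tr_{j≠i}[((⊗_{j≠i} Ω) ⊗ I_i) ρ]`. -/
noncomputable def condState (n N : ℕ) (Ω : QOp n) (ρ : Matrix (BIdx n N) (BIdx n N) ℂ) :
    QOp n :=
  (((((N : ℝ) + 1) * acceptProb n N Ω ρ : ℝ) : ℂ))⁻¹ •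
    ∑ i, ptraceAt n N i (testAll n N Ω i * ρ)

/-- The i.i.d. state `(|G⟩⟨G|)^{⊗(N+1)}`. -/
noncomputable def iidState (n N : ℕ) (θ : Fin n → Fin n → ℝ) :
    Matrix (BIdx n N) (BIdx n N) ℂ :=
  Matrix.of fun x y => ∏ j, gVec n θ (x j) * star (gVec n θ (y j))


section Helpers
set_option linter.unusedSectionVars false

/-- Tensor product of a family of matrices. -/
def tens {ι κ : Type*} [Fintype ι] (M : ι → Matrix κ κ ℂ) : Matrix (ι → κ) (ι → κ) ℂ :=
  Matrix.of fun x y => ∏ j, M j (x j) (y j)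

section tens
variable {ι κ : Type*} [Fintype ι] [DecidableEq ι] [Fintype κ] [DecidableEq κ]

lemma tens_apply (M : ι → Matrix κ κ ℂ) (x y) : tens M x y = ∏ j, M j (x j) (y j) := rfl

lemma tens_mul (M M' : ι → Matrix κ κ ℂ) : tens M * tens M' = tens fun j => M j * M' j := by
  ext x y
  simp only [Matrix.mul_apply, tens_apply, ← Finset.prod_mul_distrib]
  rw [Finset.prod_univ_sum, Fintype.piFinset_univ]

lemma tens_conj (M : ι → Matrix κ κ ℂ) : (tens M)ᴴ = tens fun j => (M j)ᴴ := by
  ext x y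
  simp [tens_apply, Matrix.conjTranspose_apply]

lemma tens_diag (d : ι → κ → ℂ) : tens (fun j => Matrix.diagonal (d j)) =
    Matrix.diagonal fun x => ∏ j, d j (x j) := by
  ext x y
  simp only [tens_apply, Matrix.diagonal_apply]
  split_ifs with hxy
  · subst hxy; simp
  · obtain ⟨j, hj⟩ := Function.ne_iff.mp hxy
    exact Finset.prod_eq_zero (Finset.mem_univ j) (by simp [hj])

lemma tens_one : tens (fun _ : ι => (1 : Matrix κ κ ℂ)) = 1 := by
  have := tens_diag (ι := ι) (κ := κ) (fun _ _ => 1)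
  simpa using this

lemma tens_trace (M : ι → Matrix κ κ ℂ) : (tens M).trace = ∏ j, (M j).trace := by
  simp only [Matrix.trace, Matrix.diag_apply, tens_apply]
  rw [Finset.prod_univ_sum, Fintype.piFinset_univ]

lemma tens_psd (M : ι → Matrix κ κ ℂ) (hM : ∀ j, (M j).PosSemidef) : (tens M).PosSemidef := by
  have h1 : ∀ j, ∃ B : Matrix κ κ ℂ, M j = Bᴴ * B := fun j => by
    open scoped MatrixOrder in
    exact CStarAlgebra.nonneg_iff_eq_star_mul_self.mp (Matrix.nonneg_iff_posSemidef.mpr (hM j))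
  choose B hB using h1
  have : tens M = (tens B)ᴴ * tens B := by
    rw [tens_conj, tens_mul]; congr 1; funext j; exact hB j
  rw [this]
  exact Matrix.posSemidef_conjTranspose_mul_self _

lemma tens_update_add (M : ι → Matrix κ κ ℂ) (i : ι) (X Y : Matrix κ κ ℂ) :
    tens (Function.update M i (X + Y)) =
      tens (Function.update M i X) + tens (Function.update M i Y) := by
  ext x y
  simp only [tens_apply, Matrix.add_apply]
  simp only [← Finset.mul_prod_erase _ _ (Finset.mem_univ i), Function.update_self,
    Matrix.add_apply, add_mul]
  congr 2 <;> exact Finset.prod_congr rfl fun j hj => by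
    simp [Function.update_of_ne (Finset.ne_of_mem_erase hj)]

lemma tens_update_smul (M : ι → Matrix κ κ ℂ) (i : ι) (c : ℂ) (X : Matrix κ κ ℂ) :
    tens (Function.update M i (c • X)) = c • tens (Function.update M i X) := by
  ext x y
  simp only [tens_apply, Matrix.smul_apply]
  simp only [← Finset.mul_prod_erase _ _ (Finset.mem_univ i), Function.update_self,
    Matrix.smul_apply, smul_eq_mul, mul_assoc]
  congr 2
  exact Finset.prod_congr rfl fun j hj => by
    simp [Function.update_of_ne (Finset.ne_of_mem_erase hj)]

lemma trace_psd_mul {α : Type*} [Fintype α] [DecidableEq α] {X ρ : Matrix α α ℂ}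
    (hX : X.PosSemidef) (hρ : ρ.PosSemidef) : 0 ≤ (X * ρ).trace.re := by
  have h1 : ∃ B : Matrix α α ℂ, X = Bᴴ * B := by
    open scoped MatrixOrder in
    exact CStarAlgebra.nonneg_iff_eq_star_mul_self.mp (Matrix.nonneg_iff_posSemidef.mpr hX)
  obtain ⟨B, rfl⟩ := h1
  rw [Matrix.mul_assoc, Matrix.trace_mul_comm]
  have := (hρ.mul_mul_conjTranspose_same B).trace_nonneg
  rw [Matrix.mul_assoc] at this
  simpa [Matrix.mul_assoc] using (Complex.le_def.mp this).1

lemma real_ineq (S : Finset ι) (lam : ι → ℝ) (h0 : ∀ i, 0 ≤ lam i) (h1 : ∀ i, lam i ≤ 1) :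
    ∑ i ∈ S, ∏ j ∈ S.erase i, lam j ≤ 1 + ((S.card : ℝ) - 1) * ∏ j ∈ S, lam j := by
  induction S using Finset.induction_on with
  | empty => simp
  | insert a S ha ih =>
    rw [Finset.sum_insert ha, Finset.erase_insert ha, Finset.prod_insert ha,
      Finset.card_insert_of_notMem ha]
    have h2 : ∑ i ∈ S, ∏ j ∈ (insert a S).erase i, lam j =
        lam a * ∑ i ∈ S, ∏ j ∈ S.erase i, lam j := by
      rw [Finset.mul_sum]
      refine Finset.sum_congr rfl fun i hi => ?_
      have : (insert a S).erase i = insert a (S.erase i) := by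
        rw [Finset.erase_insert_of_ne]; rintro rfl; exact ha hi
      rw [this, Finset.prod_insert (fun h => ha (Finset.mem_of_mem_erase h))]
    rw [h2]
    have h3 := mul_le_mul_of_nonneg_left ih (h0 a)
    have hE1 : ∏ j ∈ S, lam j ≤ 1 := Finset.prod_le_one (fun i _ => h0 i) (fun i _ => h1 i)
    have h4 := mul_nonneg (sub_nonneg.2 (h1 a)) (sub_nonneg.2 hE1)
    push_cast
    nlinarith

lemma spectral_form {Om : Matrix κ κ ℂ} (h0 : Om.PosSemidef) (h1 : (1 - Om).PosSemidef) :
    ∃ (U : Matrix κ κ ℂ) (d : κ → ℝ), U * Uᴴ = 1 ∧ Uᴴ * U = 1 ∧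
      Om = U * Matrix.diagonal (fun x => (d x : ℂ)) * Uᴴ ∧ (∀ x, 0 ≤ d x) ∧ ∀ x, d x ≤ 1 := by
  have hH := h0.1
  set U : Matrix κ κ ℂ := (hH.eigenvectorUnitary : Matrix κ κ ℂ) with hU
  have hu1 : U * Uᴴ = 1 := by
    exact Unitary.mul_star_self_of_mem hH.eigenvectorUnitary.2
  have hu2 : Uᴴ * U = 1 := by
    exact Unitary.star_mul_self_of_mem hH.eigenvectorUnitary.2
  have hs : Om = U * Matrix.diagonal (fun x => (hH.eigenvalues x : ℂ)) * Uᴴ := by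
    exact hH.spectral_theorem
  refine ⟨U, hH.eigenvalues, hu1, hu2, hs, fun x => h0.eigenvalues_nonneg x, fun x => ?_⟩
  have h3 := h1.conjTranspose_mul_mul_same U
  have h4 : Uᴴ * (1 - Om) * U = 1 - Matrix.diagonal (fun x => (hH.eigenvalues x : ℂ)) := by
    generalize hH.eigenvalues = e at hs
    rw [hs, Matrix.mul_sub, Matrix.sub_mul, Matrix.mul_one, hu2]
    congr 1
    rw [show ∀ D : Matrix κ κ ℂ, Uᴴ * (U * D * Uᴴ) * U = (Uᴴ * U) * D * (Uᴴ * U) by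
      intro D; simp only [Matrix.mul_assoc], hu2]
    simp
  rw [h4] at h3
  have h5 := h3.diag_nonneg (i := x)
  have h6 := (Complex.le_def.mp h5).1
  simpa using h6

lemma op_ineq {Om : Matrix κ κ ℂ} (h0 : Om.PosSemidef) (h1 : (1 - Om).PosSemidef)
    (ρ : Matrix (ι → κ) (ι → κ) ℂ) (hρ : ρ.PosSemidef) (ht : ρ.trace = 1) :
    ∑ i, (tens (Function.update (fun _ : ι => Om) i 1) * ρ).trace.re ≤
      1 + ((Fintype.card ι : ℝ) - 1) * (tens (fun _ : ι => Om) * ρ).trace.re := by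
  obtain ⟨U, d, hu1, hu2, hs, hd0, hd1⟩ := spectral_form h0 h1
  set V := tens (fun _ : ι => U) with hV
  set ρ' := Vᴴ * ρ * V with hρ'
  have hpsd : ρ'.PosSemidef := hρ.conjTranspose_mul_mul_same V
  have key : ∀ e : ι → κ → ℝ, (tens (fun j => U * Matrix.diagonal (fun x => (e j x : ℂ)) * Uᴴ)
      * ρ).trace.re = ∑ x, (∏ j, e j (x j)) * (ρ' x x).re := by
    intro e
    have : tens (fun j => U * Matrix.diagonal (fun x => (e j x : ℂ)) * Uᴴ) =
        V * tens (fun j => Matrix.diagonal (fun x => (e j x : ℂ))) * Vᴴ := by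
      rw [hV, tens_conj, tens_mul, tens_mul]
    rw [this, tens_diag, Matrix.mul_assoc, Matrix.mul_assoc, Matrix.trace_mul_comm,
      Matrix.mul_assoc, ← hρ', Matrix.trace]
    simp only [Matrix.diag_apply, Matrix.diagonal_mul, Complex.re_sum]
    refine Finset.sum_congr rfl fun x _ => ?_
    rw [← Complex.ofReal_prod, Complex.re_ofReal_mul]
  have hOm : tens (fun _ : ι => Om) =
      tens (fun _ => U * Matrix.diagonal (fun x => (d x : ℂ)) * Uᴴ) := by rw [← hs]
  have hup : ∀ i, tens (Function.update (fun _ : ι => Om) i 1) =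
      tens (fun j => U * Matrix.diagonal (fun x => ((if j = i then 1 else d x : ℝ) : ℂ)) * Uᴴ) := by
    intro i
    congr 1; funext j
    by_cases hj : j = i
    · subst hj; simp [hu1]
    · simp [hj, ← hs]
  have htr : ∑ x, (ρ' x x).re = 1 := by
    have := key (fun _ _ => 1)
    simp only [Complex.ofReal_one, Matrix.diagonal_one, Matrix.mul_one, hu1, tens_one,
      Matrix.one_mul, ht] at this
    simpa using this.symm
  simp only [hOm, hup, key]
  rw [Finset.sum_comm, Finset.mul_sum]
  refine le_of_le_of_eq (b := ∑ x, ((ρ' x x).re +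
    ((Fintype.card ι : ℝ) - 1) * ((∏ j, d (x j)) * (ρ' x x).re))) ?_
    (by rw [Finset.sum_add_distrib, htr])
  refine Finset.sum_le_sum fun x _ => ?_
  have hnn : 0 ≤ (ρ' x x).re := by
    simpa using (Complex.le_def.mp (hpsd.diag_nonneg (i := x))).1
  rw [← Finset.sum_mul]
  have := real_ineq Finset.univ (fun j => d (x j)) (fun _ => hd0 _) (fun _ => hd1 _)
  have h2 : ∀ i, ∏ j, (if j = i then 1 else d (x j)) = ∏ j ∈ Finset.univ.erase i, d (x j) := by
    intro i
    rw [← Finset.mul_prod_erase _ _ (Finset.mem_univ i)]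
    simp only [if_true, one_mul]
    exact Finset.prod_congr rfl fun j hj => by simp [Finset.ne_of_mem_erase hj]
  rw [Finset.card_univ, ← Finset.sum_congr rfl (fun i _ => h2 i)] at this
  nlinarith [mul_le_mul_of_nonneg_right this hnn]

/-- Two-projection lemma. -/
lemma proj_ineq {P Q : Matrix κ κ ℂ} (hP : Pᴴ = P) (hQ : Qᴴ = Q) (hPP : P * P = P)
    (hQQ : Q * Q = Q) (s : ℝ) (hs : 0 < s)
    (hyp : (Q * P * Q - ((1 - s ^ 2 : ℝ) : ℂ) • Q).PosSemidef) :
    ((s : ℂ) • 1 + P - Q).PosSemidef := by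
  set X := (s : ℂ) • 1 + P - Q with hX
  set Y := (s : ℂ) • (1 - P) - (1 - P) * Q with hY
  have hXh : Xᴴ = X := by simp [hX, hP, hQ]
  have hYh : Yᴴ = (s : ℂ) • (1 - P) - Q * (1 - P) := by
    simp [hY, hP, hQ]
  have e : ((s * (1 + s) : ℝ) : ℂ) • X = ((s : ℝ) : ℂ) • (Xᴴ * X) + Yᴴ * Y +
      (Q * P * Q - ((1 - s ^ 2 : ℝ) : ℂ) • Q) := by
    rw [hXh, hYh, hX, hY]
    have h3 : P * (P * Q) = P * Q := by rw [← Matrix.mul_assoc, hPP]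
    simp only [Matrix.mul_add, Matrix.add_mul, Matrix.mul_sub, Matrix.sub_mul, Matrix.mul_one,
      Matrix.one_mul, Matrix.smul_mul, Matrix.mul_smul, hPP, hQQ, Matrix.mul_assoc, h3]
    push_cast
    module
  have h4 : (((s * (1 + s) : ℝ) : ℂ) • X).PosSemidef := by
    rw [e]
    refine ((Matrix.posSemidef_conjTranspose_mul_self X).smul ?_ |>.add
      (Matrix.posSemidef_conjTranspose_mul_self Y)).add hyp
    exact_mod_cast hs.le
  have hpos : (0 : ℝ) < s * (1 + s) := by positivity
  have h5 : X = (((s * (1 + s))⁻¹ : ℝ) : ℂ) • (((s * (1 + s) : ℝ) : ℂ) • X) := by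
    rw [smul_smul, ← Complex.ofReal_mul, inv_mul_cancel₀ hpos.ne']; simp
  rw [h5]
  refine h4.smul ?_
  exact_mod_cast (inv_pos.2 hpos).le

end tens

/-- Uniform average over the qubits in `A`. -/
def piA (n : ℕ) (A : Finset (Fin n)) : QOp n :=
  tens fun k => if k ∈ A then Matrix.of (fun _ _ => (1 / 2 : ℂ)) else 1

lemma piA_conj (n : ℕ) (A : Finset (Fin n)) : (piA n A)ᴴ = piA n A := by
  rw [piA, tens_conj]
  congr 1; funext k
  split_ifs
  · ext a b; simp [Matrix.conjTranspose_apply]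
  · simp

lemma piA_mul (n : ℕ) (A B : Finset (Fin n)) : piA n A * piA n B = piA n (A ∪ B) := by
  rw [piA, piA, piA, tens_mul]
  congr 1; funext k
  by_cases hA : k ∈ A <;> by_cases hB : k ∈ B <;> simp [hA, hB]
  ext a b; simp [Matrix.mul_apply]

lemma piA_idem (n : ℕ) (A : Finset (Fin n)) : piA n A * piA n A = piA n A := by
  rw [piA_mul, Finset.union_self]

lemma piA_apply (n : ℕ) (A : Finset (Fin n)) (x y : QIdx n) :
    piA n A x y = if ∀ j ∉ A, x j = y j then (1 / 2 : ℂ) ^ A.card else 0 := by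
  rw [piA, tens_apply]
  split_ifs with hxy
  · rw [← Finset.prod_const, ← Finset.prod_subset (Finset.subset_univ A)]
    · exact Finset.prod_congr rfl fun k hk => by simp [hk]
    · intro k _ hk; rw [if_neg hk, hxy k hk, Matrix.one_apply_eq]
  · push Not at hxy
    obtain ⟨j, hj, hne⟩ := hxy
    exact Finset.prod_eq_zero (Finset.mem_univ j) (by simp [hj, hne])

lemma piA_swap (n : ℕ) (A : Finset (Fin n)) (x y z : QIdx n) :
    piA n A x y * piA n A y z = piA n A x y * piA n A x z := by
  simp only [piA_apply]
  by_cases hxy : ∀ j ∉ A, x j = y j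
  · have : (∀ j ∉ A, y j = z j) ↔ (∀ j ∉ A, x j = z j) :=
      forall₂_congr fun j hj => by rw [hxy j hj]
    simp only [this]
  · simp [hxy]

lemma piA_psd (n : ℕ) (A : Finset (Fin n)) : (piA n A).PosSemidef := by
  have := Matrix.posSemidef_conjTranspose_mul_self (piA n A)
  rwa [piA_conj, piA_idem] at this

lemma one_sub_piA_psd (n : ℕ) (A : Finset (Fin n)) : (1 - piA n A).PosSemidef := by
  have := Matrix.posSemidef_conjTranspose_mul_self (1 - piA n A)
  have e : (1 - piA n A)ᴴ * (1 - piA n A) = 1 - piA n A := by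
    rw [Matrix.conjTranspose_sub, piA_conj, Matrix.conjTranspose_one]
    simp [Matrix.mul_sub, Matrix.sub_mul, piA_idem]
  rwa [e] at this

lemma union_bound {n m : ℕ} (A : Fin m → Finset (Fin n)) (S : Finset (Fin m)) :
    (∑ l ∈ S, (1 - piA n (A l)) - (1 - piA n (S.biUnion A))).PosSemidef := by
  induction S using Finset.induction_on with
  | empty =>
    have : piA n ∅ = 1 := by simp [piA, tens_one]
    simp [this, Matrix.PosSemidef.zero]
  | insert a S ha ih =>
    rw [Finset.sum_insert ha, Finset.biUnion_insert]
    set X := piA n (A a)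
    set Y := piA n (S.biUnion A)
    have hXY : piA n (A a ∪ S.biUnion A) = X * Y := (piA_mul _ _ _).symm
    have hYX : Y * X = X * Y := by
      simp only [X, Y, piA_mul, Finset.union_comm]
    have hXX : X * X = X := piA_idem _ _
    have hYY : Y * Y = Y := piA_idem _ _
    have hXh : Xᴴ = X := piA_conj _ _
    have hYh : Yᴴ = Y := piA_conj _ _
    rw [hXY]
    have h2 := Matrix.posSemidef_conjTranspose_mul_self ((1 - X) * (1 - Y))
    have h3 := (one_sub_piA_psd n (A a)).mul_mul_conjTranspose_same (1 - Y)
    have e3 : (1 - Y) * (1 - X) * (1 - Y)ᴴ = 1 - X - Y + X * Y := by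
      simp only [Matrix.conjTranspose_sub, Matrix.conjTranspose_one, hYh, Matrix.mul_sub,
        Matrix.sub_mul, Matrix.mul_one, Matrix.one_mul, Matrix.mul_assoc, hYX, hYY]
      abel
    change ((1 - Y) * (1 - X) * (1 - Y)ᴴ).PosSemidef at h3
    rw [e3] at h3
    have := ih.add h3
    convert this using 1
    abel

/-- Phase of unit modulus. -/
def ph (f : QIdx n → ℝ) (x : QIdx n) : ℂ := Complex.exp (Complex.I * (f x : ℂ))

lemma ph_mul_star {n : ℕ} (f : QIdx n → ℝ) (x : QIdx n) : ph f x * star (ph f x) = 1 := by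
  have : star (ph f x) = Complex.exp (-(Complex.I * (f x : ℂ))) := by
    simp only [ph, Complex.star_def, ← Complex.exp_conj]
    simp
  rw [this, ph, ← Complex.exp_add]; simp

lemma ph_star_mul {n : ℕ} (f : QIdx n → ℝ) (x : QIdx n) : star (ph f x) * ph f x = 1 := by
  rw [mul_comm, ph_mul_star]

/-- Conjugation of the average by a phase. -/
def cj (n : ℕ) (f : QIdx n → ℝ) (M : QOp n) : QOp n :=
  Matrix.diagonal (ph f) * M * (Matrix.diagonal (ph f))ᴴ

lemma diag_ph {n : ℕ} (f : QIdx n → ℝ) :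
    (Matrix.diagonal (ph f))ᴴ * Matrix.diagonal (ph f) = 1 := by
  rw [Matrix.diagonal_conjTranspose, Matrix.diagonal_mul_diagonal, ← Matrix.diagonal_one]
  congr 1; funext x; exact ph_star_mul f x

lemma diag_ph' {n : ℕ} (f : QIdx n → ℝ) :
    Matrix.diagonal (ph f) * (Matrix.diagonal (ph f))ᴴ = 1 := by
  rw [Matrix.diagonal_conjTranspose, Matrix.diagonal_mul_diagonal, ← Matrix.diagonal_one]
  congr 1; funext x; exact ph_mul_star f x

lemma cj_mul {n : ℕ} (f : QIdx n → ℝ) (M M' : QOp n) : cj n f M * cj n f M' = cj n f (M * M') := by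
  simp only [cj]
  rw [show ∀ D : QOp n, D * M * Dᴴ * (D * M' * Dᴴ) = D * M * (Dᴴ * D) * M' * Dᴴ by
    intro D; simp only [Matrix.mul_assoc], diag_ph]
  simp only [Matrix.mul_one, Matrix.mul_assoc]

lemma cj_conj {n : ℕ} (f : QIdx n → ℝ) (M : QOp n) : (cj n f M)ᴴ = cj n f Mᴴ := by
  simp [cj, Matrix.conjTranspose_mul, Matrix.mul_assoc]

lemma cj_one {n : ℕ} (f : QIdx n → ℝ) : cj n f 1 = 1 := by
  simp only [cj, Matrix.mul_one, diag_ph']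

lemma cj_sub {n : ℕ} (f : QIdx n → ℝ) (M M' : QOp n) :
    cj n f (M - M') = cj n f M - cj n f M' := by
  simp only [cj, Matrix.mul_sub, Matrix.sub_mul]

lemma cj_smul {n : ℕ} (f : QIdx n → ℝ) (c : ℂ) (M : QOp n) :
    cj n f (c • M) = c • cj n f M := by
  simp only [cj, Matrix.mul_smul, Matrix.smul_mul]

lemma cj_sum {n : ℕ} {ι : Type*} (f : QIdx n → ℝ) (S : Finset ι) (M : ι → QOp n) :
    cj n f (∑ i ∈ S, M i) = ∑ i ∈ S, cj n f (M i) := by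
  simp only [cj, Matrix.mul_sum, Matrix.sum_mul]

lemma cj_psd {n : ℕ} (f : QIdx n → ℝ) {M : QOp n} (hM : M.PosSemidef) : (cj n f M).PosSemidef :=
  hM.mul_mul_conjTranspose_same _

lemma cj_apply {n : ℕ} (f : QIdx n → ℝ) (M : QOp n) (x y : QIdx n) :
    cj n f M x y = ph f x * M x y * star (ph f y) := by
  simp [cj, Matrix.diagonal_conjTranspose, Matrix.mul_diagonal, Matrix.diagonal_mul]

/-- exponent of the graph state. -/
def gf (n : ℕ) (θ : Fin n → Fin n → ℝ) (z : QIdx n) : ℝ :=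
  1 / 2 * ∑ j, ∑ k, θ j k * bR (z j) * bR (z k)

/-- exponent of the discretized eigenvectors. -/
def uf (n : ℕ) (θ : Fin n → Fin n → ℝ) (h : ℕ) (A : Finset (Fin n)) (z : QIdx n) : ℝ :=
  ∑ k ∈ A, alphaH h (alphaAngle n θ k z) * bR (z k)

lemma alpha_eq {n : ℕ} {θ : Fin n → Fin n → ℝ} {A : Finset (Fin n)}
    (hA : ∀ j ∈ A, ∀ k ∈ A, θ j k = 0) {x y : QIdx n} (hxy : ∀ j ∉ A, x j = y j)
    {k : Fin n} (hk : k ∈ A) : alphaAngle n θ k x = alphaAngle n θ k y := by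
  refine Finset.sum_congr rfl fun j _ => ?_
  by_cases hj : j ∈ A
  · simp [hA j hj k hk]
  · rw [hxy j hj]

lemma uf_diff {n : ℕ} {θ : Fin n → Fin n → ℝ} (h : ℕ) {A : Finset (Fin n)}
    (hA : ∀ j ∈ A, ∀ k ∈ A, θ j k = 0) {x y : QIdx n} (hxy : ∀ j ∉ A, x j = y j) :
    uf n θ h A x - uf n θ h A y =
      ∑ k ∈ A, alphaH h (alphaAngle n θ k x) * (bR (x k) - bR (y k)) := by
  rw [uf, uf, ← Finset.sum_sub_distrib]
  refine Finset.sum_congr rfl fun k hk => ?_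
  rw [alpha_eq hA hxy hk]; ring

lemma gf_diff {n : ℕ} {θ : Fin n → Fin n → ℝ} (hsym : ∀ j k, θ j k = θ k j)
    {A : Finset (Fin n)}
    (hA : ∀ j ∈ A, ∀ k ∈ A, θ j k = 0) {x y : QIdx n} (hxy : ∀ j ∉ A, x j = y j) :
    gf n θ x - gf n θ y =
      ∑ k ∈ A, alphaAngle n θ k x * (bR (x k) - bR (y k)) := by
  have h1 : ∑ j, ∑ k, θ j k * (bR (x j) * bR (y k)) = ∑ j, ∑ k, θ j k * (bR (y j) * bR (x k)) := by
    rw [Finset.sum_comm]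
    refine Finset.sum_congr rfl fun j _ => Finset.sum_congr rfl fun k _ => ?_
    rw [hsym]; ring
  have h2 : gf n θ x - gf n θ y =
      1 / 2 * ∑ j, (bR (x j) - bR (y j)) * (alphaAngle n θ j x + alphaAngle n θ j y) := by
    have : ∑ j, (bR (x j) - bR (y j)) * (alphaAngle n θ j x + alphaAngle n θ j y) =
        ∑ j, ∑ k, θ j k * bR (x j) * bR (x k) - ∑ j, ∑ k, θ j k * bR (y j) * bR (y k) +
        (∑ j, ∑ k, θ j k * (bR (x j) * bR (y k)) - ∑ j, ∑ k, θ j k * (bR (y j) * bR (x k))) := by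
      simp only [← Finset.sum_sub_distrib, ← Finset.sum_add_distrib, alphaAngle, Finset.mul_sum]
      refine Finset.sum_congr rfl fun j _ => Finset.sum_congr rfl fun k _ => ?_
      rw [hsym k j]; ring
    rw [this, h1, gf, gf]; ring
  rw [h2, ← Finset.sum_subset (Finset.subset_univ A) (fun j _ hj => by simp [hxy j hj]),
    Finset.mul_sum]
  refine Finset.sum_congr rfl fun k hk => ?_
  rw [alpha_eq hA hxy hk]; ring

lemma ph_mul_star_diff {n : ℕ} (f : QIdx n → ℝ) (x y : QIdx n) :
    ph f x * star (ph f y) = Complex.exp (Complex.I * ((f x - f y : ℝ) : ℂ)) := by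
  have : star (ph f y) = Complex.exp (-(Complex.I * (f y : ℂ))) := by
    simp only [ph, Complex.star_def, ← Complex.exp_conj]
    simp
  rw [this, ph, ← Complex.exp_add]; congr 1; push_cast; ring

lemma PopH_eq {n : ℕ} {θ : Fin n → Fin n → ℝ} (h : ℕ) {A : Finset (Fin n)}
    (hA : ∀ j ∈ A, ∀ k ∈ A, θ j k = 0) :
    PopH n θ h A = cj n (uf n θ h A) (piA n A) := by
  ext x y
  rw [cj_apply, piA_apply]
  simp only [PopH, Matrix.of_apply]
  split_ifs with hxy
  · rw [mul_right_comm, ph_mul_star_diff, uf_diff h hA hxy]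
    simp only [phaseFac, Finset.prod_mul_distrib, Finset.prod_const, ← Complex.exp_sum]
    rw [mul_comm]
    push_cast
    rw [Finset.mul_sum]
  · simp

lemma gVec_eq (n : ℕ) (θ : Fin n → Fin n → ℝ) (z : QIdx n) :
    gVec n θ z = ((Real.sqrt (2 ^ n))⁻¹ : ℝ) * ph (gf n θ) z := rfl

lemma gProj_eq (n : ℕ) (θ : Fin n → Fin n → ℝ) :
    gProj n θ = cj n (gf n θ) (piA n Finset.univ) := by
  ext x y
  rw [cj_apply, piA_apply]
  simp only [gProj, Matrix.vecMulVec_apply, Pi.star_apply, gVec_eq, star_mul']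
  have h1 : (((Real.sqrt (2 ^ n))⁻¹ : ℝ) : ℂ) * (((Real.sqrt (2 ^ n))⁻¹ : ℝ) : ℂ)
      = (1 / 2 : ℂ) ^ n := by
    rw [← Complex.ofReal_mul, ← mul_inv, Real.mul_self_sqrt (by positivity)]
    simp
  have h2 : star (((Real.sqrt (2 ^ n))⁻¹ : ℝ) : ℂ) = (((Real.sqrt (2 ^ n))⁻¹ : ℝ) : ℂ) := by
    simp
  rw [h2]
  simp only [Finset.mem_univ, not_true_eq_false, IsEmpty.forall_iff, implies_true, if_true,
    Finset.card_univ, Fintype.card_fin, ← h1]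
  ring

lemma alphaH_close (h : ℕ) (hh : 1 ≤ h) (α : ℝ) : |α - alphaH h α| ≤ Real.pi / (2 * h) := by
  have hpi := Real.pi_pos
  have hh' : (0 : ℝ) < h := by exact_mod_cast hh
  have h1 := Int.floor_le ((h : ℝ) * α / Real.pi + 1 / 2)
  have h2 := Int.lt_floor_add_one ((h : ℝ) * α / Real.pi + 1 / 2)
  unfold alphaH
  set F : ℝ := ((⌊(h : ℝ) * α / Real.pi + 1 / 2⌋ : ℤ) : ℝ)
  have e : α - F * Real.pi / h = ((h : ℝ) * α / Real.pi - F) * (Real.pi / h) := by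
    field_simp
  have e2 : Real.pi / (2 * h) = 1 / 2 * (Real.pi / h) := by field_simp
  rw [e, e2, abs_mul, abs_of_pos (show 0 < Real.pi / h by positivity)]
  refine mul_le_mul_of_nonneg_right ?_ (by positivity)
  rw [abs_le]; constructor <;> linarith

lemma half_phase (δ : ℝ) (a : Fin 2) :
    Complex.normSq (∑ b : Fin 2, (1 / 2 : ℂ) *
      Complex.exp (Complex.I * ((δ * (bR a - bR b) : ℝ) : ℂ))) = Real.cos (δ / 2) ^ 2 := by
  have h3 : Real.cos δ = 2 * Real.cos (δ / 2) ^ 2 - 1 := by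
    rw [← Real.cos_two_mul]; congr 1; ring
  have h4 := Real.sin_sq_add_cos_sq δ
  have key : ∀ t : ℝ, Complex.exp (Complex.I * (t : ℂ)) = ⟨Real.cos t, Real.sin t⟩ := by
    intro t
    rw [mul_comm, Complex.exp_mul_I, ← Complex.ofReal_cos, ← Complex.ofReal_sin]
    apply Complex.ext <;> simp [-Complex.ofReal_cos, -Complex.ofReal_sin]
  simp only [key]
  have hhalf : (1 / 2 : ℂ) = ((1 / 2 : ℝ) : ℂ) := by push_cast; rfl
  rw [hhalf]
  fin_cases a <;>
    · simp [Fin.sum_univ_two, bR, Complex.normSq_apply]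
      nlinarith

lemma cos_bound (h : ℕ) (hh : 1 ≤ h) (δ : ℝ) (hδ : |δ| ≤ Real.pi / (2 * h)) :
    1 - Real.sin (Real.pi / (4 * h)) ^ 2 ≤ Real.cos (δ / 2) ^ 2 := by
  have hpi := Real.pi_pos
  have hh' : (1 : ℝ) ≤ h := by exact_mod_cast hh
  have e : 1 - Real.sin (Real.pi / (4 * h)) ^ 2 = Real.cos (Real.pi / (4 * h)) ^ 2 := by
    have := Real.sin_sq_add_cos_sq (Real.pi / (4 * h)); linarith
  have e2 : Real.pi / (4 * h) = Real.pi / (2 * h) / 2 := by field_simp; ring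
  have hle : Real.pi / (4 * h) ≤ Real.pi / 4 := by
    apply div_le_div_of_nonneg_left hpi.le (by norm_num); linarith
  rw [e, ← Real.cos_abs (δ / 2)]
  have hd : |δ / 2| ≤ Real.pi / (4 * h) := by
    rw [e2, abs_div, abs_two]; linarith
  have h1 : Real.cos (Real.pi / (4 * h)) ≤ Real.cos |δ / 2| :=
    Real.cos_le_cos_of_nonneg_of_le_pi (abs_nonneg _) (by linarith) hd
  have h2 : 0 ≤ Real.cos (Real.pi / (4 * h)) :=
    Real.cos_nonneg_of_neg_pi_div_two_le_of_le
      (by have : 0 < Real.pi / (4 * h) := by positivity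
          linarith) (by linarith)
  exact pow_le_pow_left₀ h2 h1 2

/-- phase difference exponent. -/
def wf (n : ℕ) (θ : Fin n → Fin n → ℝ) (h : ℕ) (A : Finset (Fin n)) (z : QIdx n) : ℝ :=
  uf n θ h A z - gf n θ z

/-- block average of the phase difference. -/
def ev (n : ℕ) (θ : Fin n → Fin n → ℝ) (h : ℕ) (A : Finset (Fin n)) (x : QIdx n) : ℂ :=
  ∑ y, piA n A x y * ph (wf n θ h A) y

lemma ev_bound {n : ℕ} {θ : Fin n → Fin n → ℝ} (hsym : ∀ j k, θ j k = θ k j) (h : ℕ) (hh : 1 ≤ h)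
    {A : Finset (Fin n)} (hA : ∀ j ∈ A, ∀ k ∈ A, θ j k = 0) (x : QIdx n) :
    (1 - Real.sin (Real.pi / (4 * h)) ^ 2) ^ A.card ≤ Complex.normSq (ev n θ h A x) := by
  set δ : Fin n → ℝ := fun k => alphaAngle n θ k x - alphaH h (alphaAngle n θ k x) with hδ
  have e1 : ev n θ h A x = ph (wf n θ h A) x *
      ∏ k ∈ A, ∑ b : Fin 2, (1 / 2 : ℂ) *
        Complex.exp (Complex.I * ((δ k * (bR (x k) - bR b) : ℝ) : ℂ)) := by
    have e2 : ∀ y, piA n A x y * ph (wf n θ h A) y = ph (wf n θ h A) x *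
        ∏ k, ((if k ∈ A then Matrix.of (fun _ _ => (1 / 2 : ℂ)) else 1 : Matrix (Fin 2) (Fin 2) ℂ)
          (x k) (y k) * (if k ∈ A then
          Complex.exp (Complex.I * ((δ k * (bR (x k) - bR (y k)) : ℝ) : ℂ)) else 1)) := by
      intro y
      rw [Finset.prod_mul_distrib]
      change _ = ph (wf n θ h A) x * (piA n A x y * _)
      by_cases hxy : ∀ j ∉ A, x j = y j
      · rw [Finset.prod_ite_mem, Finset.univ_inter, ← Complex.exp_sum, mul_left_comm]
        congr 1
        rw [ph, ph, ← Complex.exp_add]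
        congr 1
        rw [← Finset.mul_sum, ← mul_add, ← Complex.ofReal_sum, ← Complex.ofReal_add]
        congr 2
        have h1 := uf_diff h hA hxy
        have h2 := gf_diff hsym hA hxy
        simp only [hδ, wf, sub_mul, Finset.sum_sub_distrib, ← h1, ← h2]
        ring
      · rw [piA_apply, if_neg hxy]; simp
    simp only [ev, e2]
    rw [← Finset.mul_sum]
    congr 1
    rw [← Fintype.piFinset_univ, ← Finset.prod_univ_sum (fun _ => Finset.univ)
      (fun k b => ((if k ∈ A then Matrix.of (fun _ _ => (1 / 2 : ℂ)) else 1 :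
          Matrix (Fin 2) (Fin 2) ℂ)
          (x k) b * (if k ∈ A then
          Complex.exp (Complex.I * ((δ k * (bR (x k) - bR b) : ℝ) : ℂ)) else 1)))]
    rw [← Finset.prod_subset (Finset.subset_univ A)]
    · exact Finset.prod_congr rfl fun k hk => by simp [hk]
    · intro k _ hk; simp [hk, Matrix.one_apply]
  have e3 : Complex.normSq (ph (wf n θ h A) x) = 1 := by
    have := ph_mul_star (wf n θ h A) x
    rw [Complex.star_def, Complex.mul_conj] at this
    exact_mod_cast this
  rw [e1, Complex.normSq_mul, e3, one_mul, map_prod, ← Finset.prod_const]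
  refine Finset.prod_le_prod (fun k _ => ?_) (fun k _ => ?_)
  · have := Real.sin_sq_le_one (Real.pi / (4 * h)); linarith
  · rw [half_phase]
    exact cos_bound h hh _ (alphaH_close h hh _)

lemma diag_g_u (n : ℕ) (θ : Fin n → Fin n → ℝ) (h : ℕ) (A : Finset (Fin n)) :
    (Matrix.diagonal (ph (gf n θ)))ᴴ * Matrix.diagonal (ph (uf n θ h A)) =
      Matrix.diagonal (ph (wf n θ h A)) := by
  rw [Matrix.diagonal_conjTranspose, Matrix.diagonal_mul_diagonal]
  congr 1; funext x
  have : ph (uf n θ h A) x = ph (gf n θ) x * ph (wf n θ h A) x := by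
    simp only [ph, ← Complex.exp_add, wf]; congr 1; push_cast; ring
  rw [this, Pi.star_apply, ← mul_assoc, ph_star_mul, one_mul]

lemma PWP (n : ℕ) (θ : Fin n → Fin n → ℝ) (h : ℕ) (A : Finset (Fin n)) :
    piA n A * Matrix.diagonal (ph (wf n θ h A)) * piA n A =
      Matrix.diagonal (ev n θ h A) * piA n A := by
  ext x z
  rw [Matrix.diagonal_mul, Matrix.mul_apply, ev, Finset.sum_mul]
  refine Finset.sum_congr rfl fun y _ => ?_
  rw [Matrix.mul_diagonal, mul_right_comm, piA_swap]; ring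

lemma single_proj {n : ℕ} {θ : Fin n → Fin n → ℝ} (hsym : ∀ j k, θ j k = θ k j) (h : ℕ)
    (hh : 1 ≤ h) {A : Finset (Fin n)} (hA : ∀ j ∈ A, ∀ k ∈ A, θ j k = 0) (hne : A.Nonempty) :
    (((A.card * Real.sin (Real.pi / (4 * h)) : ℝ) : ℂ) • 1 + cj n (gf n θ) (piA n A) -
      PopH n θ h A).PosSemidef := by
  have hpi := Real.pi_pos
  have hh' : (1 : ℝ) ≤ h := by exact_mod_cast hh
  have hle : Real.pi / (4 * h) ≤ Real.pi / 4 := by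
    apply div_le_div_of_nonneg_left hpi.le (by norm_num); linarith
  have hs : 0 < Real.sin (Real.pi / (4 * h)) :=
    Real.sin_pos_of_pos_of_lt_pi (by positivity) (by linarith)
  have hs1 := Real.sin_le_one (Real.pi / (4 * h))
  have hc : (1 : ℝ) ≤ A.card := by exact_mod_cast hne.card_pos
  rw [PopH_eq h hA]
  have hpos : 0 < A.card * Real.sin (Real.pi / (4 * h)) := by positivity
  have hcc : ∀ x, 1 - (A.card * Real.sin (Real.pi / (4 * h))) ^ 2 ≤
      Complex.normSq (ev n θ h A x) := by
    intro x
    refine le_trans ?_ (ev_bound hsym h hh hA x)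
    have h1 := one_add_mul_le_pow (a := -(Real.sin (Real.pi / (4 * h)) ^ 2)) (by nlinarith) A.card
    rw [← sub_eq_add_neg 1] at h1
    refine le_trans ?_ h1
    nlinarith [mul_nonneg (mul_nonneg (sub_nonneg.2 hc) (zero_le_one.trans hc)) (sq_nonneg (Real.sin (Real.pi / (4 * h))))]
  generalize A.card * Real.sin (Real.pi / (4 * h)) = s at hpos hcc
  refine proj_ineq ?_ ?_ ?_ ?_ _ hpos ?_
  · rw [cj_conj, piA_conj]
  · rw [cj_conj, piA_conj]
  · rw [cj_mul, piA_idem]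
  · rw [cj_mul, piA_idem]
  set Pj := piA n A with hPi
  have hW := diag_g_u n θ h A
  have hPWP := PWP n θ h A
  rw [← hPi] at hPWP
  set Dg := Matrix.diagonal (ph (gf n θ))
  set W := Matrix.diagonal (ph (wf n θ h A))
  have e1 : cj n (uf n θ h A) Pj * cj n (gf n θ) Pj * cj n (uf n θ h A) Pj =
      cj n (uf n θ h A) ((Pj * W * Pj)ᴴ * (Pj * W * Pj)) := by
    have hid : ∀ X : QOp n, Pj * (Pj * X) = Pj * X := fun X => by
      rw [← Matrix.mul_assoc, hPi, piA_idem]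
    have hcj : Pjᴴ = Pj := piA_conj _ _
    rw [← hW]
    simp only [cj, Matrix.conjTranspose_mul, Matrix.conjTranspose_conjTranspose, hcj,
      Matrix.mul_assoc, hid]
    rfl
  have e2 : cj n (uf n θ h A) Pj * cj n (gf n θ) Pj * cj n (uf n θ h A) Pj -
      ((1 - s ^ 2 : ℝ) : ℂ) • cj n (uf n θ h A) Pj =
      cj n (uf n θ h A) (Pjᴴ * Matrix.diagonal (fun x =>
        ((Complex.normSq (ev n θ h A x) - (1 - s ^ 2) : ℝ) : ℂ)) * Pj) := by
    have e3 : (Matrix.diagonal (fun x =>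
        ((Complex.normSq (ev n θ h A x) - (1 - s ^ 2) : ℝ) : ℂ)) : QOp n) =
        (Matrix.diagonal (ev n θ h A))ᴴ * Matrix.diagonal (ev n θ h A) -
        ((1 - s ^ 2 : ℝ) : ℂ) • 1 := by
      rw [Matrix.diagonal_conjTranspose, Matrix.diagonal_mul_diagonal, ← Matrix.diagonal_one,
        ← Matrix.diagonal_smul, Matrix.diagonal_sub]
      congr 1; funext x
      rw [Complex.ofReal_sub, Complex.normSq_eq_conj_mul_self]
      simp
    rw [e1, hPWP, e3]
    have hid : Pj * Pj = Pj := piA_idem _ _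
    have hcj : Pjᴴ = Pj := piA_conj _ _
    rw [Matrix.mul_sub, Matrix.sub_mul, cj_sub, hcj, Matrix.mul_smul, Matrix.mul_one,
      Matrix.smul_mul, hid, cj_smul, Matrix.conjTranspose_mul, hcj]
    simp only [Matrix.mul_assoc]
  rw [e2]
  refine cj_psd _ (Matrix.PosSemidef.conjTranspose_mul_mul_same
    (Matrix.PosSemidef.diagonal fun x => ?_) _)
  have := sub_nonneg.2 (hcc x)
  simp only [Pi.zero_apply]
  exact_mod_cast this

lemma testAll_eq (n N : ℕ) (Om : QOp n) (i : Fin (N + 1)) :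
    testAll n N Om i = tens (Function.update (fun _ => Om) i 1) := by
  ext x y
  rw [tens_apply, ← Finset.mul_prod_erase _ _ (Finset.mem_univ i)]
  simp only [testAll, Matrix.of_apply, Function.update_self, Matrix.one_apply]
  congr 1
  exact Finset.prod_congr rfl fun j hj => by
    rw [Function.update_of_ne (Finset.ne_of_mem_erase hj)]

lemma ptrace_trace (n N : ℕ) (i : Fin (N + 1)) (M : Matrix (BIdx n N) (BIdx n N) ℂ) (K : QOp n) :
    (ptraceAt n N i M * K).trace = (M * tens (Function.update (fun _ => 1) i K)).trace := by
  simp only [Matrix.trace, Matrix.diag_apply, Matrix.mul_apply, ptraceAt, Matrix.of_apply,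
    Finset.sum_mul]
  have h1 : ∀ x : BIdx n N, ∑ y, M x y * tens (Function.update (fun _ => 1) i K) y x =
      ∑ b, M x (Function.update x i b) * K b (x i) := by
    intro x
    symm
    refine Fintype.sum_of_injective (fun b => Function.update x i b)
      (Function.update_injective x i) _ _ ?_ ?_
    · intro y hy
      have : ∃ j, j ≠ i ∧ y j ≠ x j := by
        by_contra hcon
        push Not at hcon
        refine hy ⟨y i, ?_⟩
        funext j
        by_cases hj : j = i
        · subst hj; simp
        · simp [hj, hcon j hj]
      obtain ⟨j, hj, hne⟩ := this
      rw [tens_apply, Finset.prod_eq_zero (Finset.mem_univ j), mul_zero]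
      rw [Function.update_of_ne hj, Matrix.one_apply_ne hne]
    · intro b
      rw [tens_apply, ← Finset.mul_prod_erase _ _ (Finset.mem_univ i)]
      rw [Finset.prod_eq_one]
      · simp
      · intro j hj
        have hj' := Finset.ne_of_mem_erase hj
        rw [Function.update_of_ne hj', Function.update_of_ne hj', Matrix.one_apply_eq]
  simp only [h1, ite_mul, zero_mul]
  have h2 : ∀ a : QIdx n, ∑ b : QIdx n, ∑ x : BIdx n N,
      (if x i = a then M x (Function.update x i b) * K b a else 0) =
      ∑ x : BIdx n N, if x i = a then ∑ b : QIdx n, M x (Function.update x i b) * K b a else 0 := by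
    intro a
    rw [Finset.sum_comm]
    refine Finset.sum_congr rfl fun x _ => ?_
    split_ifs <;> simp
  simp only [h2]
  rw [Finset.sum_comm]
  refine Finset.sum_congr rfl fun x _ => ?_
  rw [Finset.sum_ite_eq]; simp

lemma quad_trace {α : Type*} [Fintype α] (M : Matrix α α ℂ) (v : α → ℂ) :
    star v ⬝ᵥ (M *ᵥ v) = (M * Matrix.vecMulVec v (star v)).trace := by
  rw [Matrix.mul_vecMulVec, Matrix.trace_vecMulVec, dotProduct_comm]

lemma PopH_psd {n : ℕ} {θ : Fin n → Fin n → ℝ} (h : ℕ) {A : Finset (Fin n)}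
    (hA : ∀ j ∈ A, ∀ k ∈ A, θ j k = 0) : (PopH n θ h A).PosSemidef := by
  rw [PopH_eq h hA]; exact cj_psd _ (piA_psd _ _)

lemma one_sub_PopH_psd {n : ℕ} {θ : Fin n → Fin n → ℝ} (h : ℕ) {A : Finset (Fin n)}
    (hA : ∀ j ∈ A, ∀ k ∈ A, θ j k = 0) : (1 - PopH n θ h A).PosSemidef := by
  rw [PopH_eq h hA, ← cj_one (uf n θ h A), ← cj_sub]; exact cj_psd _ (one_sub_piA_psd _ _)

lemma inv_nat_nonneg (m : ℕ) : (0 : ℂ) ≤ (m : ℂ)⁻¹ := by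
  have : (0 : ℝ) ≤ (m : ℝ)⁻¹ := by positivity
  have h2 := Complex.real_le_real.mpr this
  push_cast at h2
  exact h2

lemma Omega_psd {n m : ℕ} {θ : Fin n → Fin n → ℝ} (h : ℕ) {A : Fin m → Finset (Fin n)}
    (hA : ∀ l, ∀ j ∈ A l, ∀ k ∈ A l, θ j k = 0) : (OmegaAH n m θ h A).PosSemidef :=
  (Matrix.posSemidef_sum _ fun l _ => PopH_psd h (hA l)).smul (inv_nat_nonneg m)

lemma one_sub_Omega_psd {n m : ℕ} (hm : 1 ≤ m) {θ : Fin n → Fin n → ℝ} (h : ℕ)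
    {A : Fin m → Finset (Fin n)}
    (hA : ∀ l, ∀ j ∈ A l, ∀ k ∈ A l, θ j k = 0) : (1 - OmegaAH n m θ h A).PosSemidef := by
  have hm' : (m : ℂ) ≠ 0 := by exact_mod_cast (by omega : m ≠ 0)
  have : 1 - OmegaAH n m θ h A = (m : ℂ)⁻¹ • ∑ l, (1 - PopH n θ h (A l)) := by
    rw [Finset.sum_sub_distrib, smul_sub, OmegaAH]
    congr 1
    simp only [Finset.sum_const, Finset.card_univ, Fintype.card_fin, ← Nat.cast_smul_eq_nsmul ℂ,
      smul_smul, inv_mul_cancel₀ hm', one_smul]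
  rw [this]
  exact (Matrix.posSemidef_sum _ fun l _ => one_sub_PopH_psd h (hA l)).smul (inv_nat_nonneg m)

lemma single_copy {n m : ℕ} (hm : 1 ≤ m) {θ : Fin n → Fin n → ℝ} (hsym : ∀ j k, θ j k = θ k j)
    (h : ℕ) (hh : 1 ≤ h) {A : Fin m → Finset (Fin n)}
    (hA : ∀ l, ∀ j ∈ A l, ∀ k ∈ A l, θ j k = 0)
    (hdisj : ∀ l l', l ≠ l' → Disjoint (A l) (A l'))
    (hcover : ∀ v : Fin n, ∃ l, v ∈ A l) (hne : ∀ l, (A l).Nonempty) :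
    (gProj n θ + -((((1 - m - n * Real.sin (Real.pi / (4 * h)) : ℝ) : ℂ) • (1 : QOp n)
      + (m : ℂ) • OmegaAH n m θ h A))).PosSemidef := by
  have hm' : (m : ℂ) ≠ 0 := by exact_mod_cast (by omega : m ≠ 0)
  have hU : Finset.univ.biUnion A = Finset.univ := by
    ext v; simpa using hcover v
  have hcard : ∑ l, (A l).card = n := by
    rw [← Finset.card_biUnion (fun l _ l' _ hl => hdisj l l' hl), hU]; simp
  have hcard' : (∑ l, ((A l).card : ℂ)) = n := by exact_mod_cast hcard
  have h1 := cj_psd (gf n θ) (union_bound A Finset.univ)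
  rw [hU, cj_sub, cj_sub, cj_sum, ← gProj_eq, cj_one] at h1
  simp only [cj_sub, cj_one] at h1
  have h2 := Matrix.posSemidef_sum Finset.univ
    fun l _ => single_proj (θ := θ) hsym h hh (hA l) (hne l)
  convert h1.add h2 using 1
  rw [OmegaAH, smul_smul, mul_inv_cancel₀ hm', one_smul]
  simp only [Finset.sum_sub_distrib, Finset.sum_add_distrib, ← Finset.sum_smul,
    Finset.sum_const, Finset.card_univ, Fintype.card_fin, ← Nat.cast_smul_eq_nsmul ℂ]
  push_cast
  rw [← Finset.sum_mul, hcard']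
  module

lemma quad_PopH {n : ℕ} {θ : Fin n → Fin n → ℝ} (hsym : ∀ j k, θ j k = θ k j) (h : ℕ)
    (hh : 1 ≤ h) {A : Finset (Fin n)} (hA : ∀ j ∈ A, ∀ k ∈ A, θ j k = 0) :
    ((((1 - Real.sin (Real.pi / (4 * h)) ^ 2) ^ A.card : ℝ)) : ℂ) ≤
      (PopH n θ h A * gProj n θ).trace := by
  have e : (PopH n θ h A * gProj n θ).trace =
      ((∑ x, (1 / 2 : ℝ) ^ n * Complex.normSq (ev n θ h A x) : ℝ) : ℂ) := by
    rw [gProj, ← quad_trace, PopH_eq h hA]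
    have h1 : cj n (uf n θ h A) (piA n A) =
        (piA n A * (Matrix.diagonal (ph (uf n θ h A)))ᴴ)ᴴ *
        (piA n A * (Matrix.diagonal (ph (uf n θ h A)))ᴴ) := by
      rw [Matrix.conjTranspose_mul, piA_conj, Matrix.conjTranspose_conjTranspose, cj]
      conv_lhs => rw [← piA_idem]
      simp only [Matrix.mul_assoc]
    rw [h1]
    set B := piA n A * (Matrix.diagonal (ph (uf n θ h A)))ᴴ with hB
    have h2 : ∀ x, (B *ᵥ gVec n θ) x = ((Real.sqrt (2 ^ n))⁻¹ : ℝ) * star (ev n θ h A x) := by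
      intro x
      rw [Matrix.mulVec, dotProduct, ev, star_sum, Finset.mul_sum]
      refine Finset.sum_congr rfl fun y _ => ?_
      have h3 : star (ph (wf n θ h A) y) = star (ph (uf n θ h A) y) * ph (gf n θ) y := by
        have : ph (uf n θ h A) y = ph (gf n θ) y * ph (wf n θ h A) y := by
          simp only [ph, ← Complex.exp_add, wf]; congr 1; push_cast; ring
        rw [this, star_mul', mul_right_comm, ph_star_mul, one_mul]
      have h4 : star (piA n A x y) = piA n A x y := by
        rw [piA_apply]; split_ifs <;> simp
      rw [star_mul', h3, h4, gVec_eq, hB, Matrix.diagonal_conjTranspose, Matrix.mul_diagonal,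
        Pi.star_apply]
      ring
    rw [← Matrix.mulVec_mulVec, Matrix.dotProduct_mulVec, ← Matrix.star_mulVec, dotProduct,
      Complex.ofReal_sum]
    refine Finset.sum_congr rfl fun x _ => ?_
    rw [Pi.star_apply, h2, Complex.star_def, ← Complex.normSq_eq_conj_mul_self]
    congr 1
    rw [Complex.normSq_mul, Complex.normSq_ofReal, ← mul_inv,
      Real.mul_self_sqrt (by positivity), Complex.normSq_conj]
    simp
  rw [e]
  refine Complex.real_le_real.mpr ?_
  have : ∑ x : QIdx n, (1 / 2 : ℝ) ^ n * (1 - Real.sin (Real.pi / (4 * h)) ^ 2) ^ A.card =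
      (1 - Real.sin (Real.pi / (4 * h)) ^ 2) ^ A.card := by
    rw [Finset.sum_const, Finset.card_univ, Fintype.card_fun, Fintype.card_fin, Fintype.card_fin,
      nsmul_eq_mul, ← mul_assoc]
    push_cast
    rw [← mul_pow]; norm_num
  rw [← this]
  exact Finset.sum_le_sum fun x _ =>
    mul_le_mul_of_nonneg_left (ev_bound hsym h hh hA x) (by positivity)

lemma gProj_trace (n : ℕ) (θ : Fin n → Fin n → ℝ) : (gProj n θ).trace = 1 := by
  rw [gProj_eq, cj, Matrix.mul_assoc, Matrix.trace_mul_comm, Matrix.mul_assoc, diag_ph,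
    Matrix.mul_one, piA, tens_trace]
  refine Finset.prod_eq_one fun k _ => ?_
  simp [Matrix.trace]

lemma iid_eq (n N : ℕ) (θ : Fin n → Fin n → ℝ) :
    iidState n N θ = tens (fun _ => gProj n θ) := by
  ext x y; rfl

end Helpers

/-- Theorem 2 of the paper (adaptive protocol with imperfect match): the i.i.d. state
`(|G⟩⟨G|)^{⊗(N+1)}` passes the `N`-random sampling test of `Ω_h(𝒜)` with probability at
least `(1 - sin²(π/4h))^{N·max_l |A_l|}`, and for `β ≥ 1/(N+1)` any state passing with
probability `≥ β` leaves a conditional state `σ` with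
`⟨G|σ|G⟩ ≥ 1 - [m(1-β)/(βN) + n sin(π/4h)]`. -/
theorem adaptive_imperfect_match
    (n m : ℕ) (hn : 1 ≤ n) (hm : 1 ≤ m)
    (G : SimpleGraph (Fin n)) (θ : Fin n → Fin n → ℝ)
    (hsym : ∀ j k, θ j k = θ k j)
    (hθ : ∀ j k, ¬ G.Adj j k → θ j k = 0)
    (A : Fin m → Finset (Fin n))
    (hdisj : ∀ l l', l ≠ l' → Disjoint (A l) (A l'))
    (hcover : ∀ v : Fin n, ∃ l, v ∈ A l)
    (hne : ∀ l, (A l).Nonempty)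
    (hind : ∀ l, ∀ j ∈ A l, ∀ k ∈ A l, ¬ G.Adj j k)
    (h : ℕ) (hh : 1 ≤ h) (N : ℕ) (hN : 1 ≤ N)
    (β : ℝ) (hβ0 : 0 < β) (hβ1 : β ≤ 1) (hβ : 1 / ((N : ℝ) + 1) ≤ β) :
    (1 - Real.sin (Real.pi / (4 * h)) ^ 2) ^ (N * Finset.univ.sup fun l => (A l).card) ≤
      acceptProb n N (OmegaAH n m θ h A) (iidState n N θ) ∧
    ∀ ρ : Matrix (BIdx n N) (BIdx n N) ℂ, ρ.PosSemidef → ρ.trace = 1 →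
      β ≤ acceptProb n N (OmegaAH n m θ h A) ρ →
      1 - ((m : ℝ) * (1 - β) / (β * N) + (n : ℝ) * Real.sin (Real.pi / (4 * h))) ≤
        (star (gVec n θ) ⬝ᵥ (condState n N (OmegaAH n m θ h A) ρ *ᵥ gVec n θ)).re := by
  have hA : ∀ l, ∀ j ∈ A l, ∀ k ∈ A l, θ j k = 0 :=
    fun l j hj k hk => hθ j k (hind l j hj k hk)
  have h0 := Omega_psd (θ := θ) h hA
  have h1 := one_sub_Omega_psd hm (θ := θ) h hA
  have hm' : (0 : ℝ) < m := by exact_mod_cast hm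
  have hNp : (0 : ℝ) < N := by exact_mod_cast hN
  constructor
  · set q : ℝ := 1 - Real.sin (Real.pi / (4 * h)) ^ 2 with hq
    set mx := Finset.univ.sup fun l => (A l).card with hmx
    have hq0 : 0 ≤ q := by have := Real.sin_sq_le_one (Real.pi / (4 * h)); linarith
    have hq1 : q ≤ 1 := by have := sq_nonneg (Real.sin (Real.pi / (4 * h))); linarith
    have hT : ((q ^ mx : ℝ) : ℂ) ≤ (OmegaAH n m θ h A * gProj n θ).trace := by
      rw [OmegaAH, Matrix.smul_mul, Matrix.trace_smul, Matrix.sum_mul, Matrix.trace_sum,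
        smul_eq_mul]
      have h2 : ∑ _l : Fin m, ((q ^ mx : ℝ) : ℂ) ≤ ∑ l, (PopH n θ h (A l) * gProj n θ).trace := by
        refine Finset.sum_le_sum fun l _ => le_trans ?_ (quad_PopH hsym h hh (hA l))
        refine Complex.real_le_real.mpr (pow_le_pow_of_le_one hq0 hq1 ?_)
        exact Finset.le_sup (f := fun l => (A l).card) (Finset.mem_univ l)
      have h3 := mul_le_mul_of_nonneg_left h2 (inv_nat_nonneg m)
      refine le_trans (le_of_eq ?_) h3
      have : (m : ℂ) ≠ 0 := by exact_mod_cast hm'.ne'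
      rw [Finset.sum_const, Finset.card_univ, Fintype.card_fin, nsmul_eq_mul, ← mul_assoc,
        inv_mul_cancel₀ this, one_mul]
    have hterm : ∀ i, (testAll n N (OmegaAH n m θ h A) i * iidState n N θ).trace =
        (OmegaAH n m θ h A * gProj n θ).trace ^ N := by
      intro i
      rw [testAll_eq, iid_eq, tens_mul, tens_trace,
        ← Finset.mul_prod_erase _ _ (Finset.mem_univ i), Function.update_self, Matrix.one_mul,
        gProj_trace, one_mul]
      rw [Finset.prod_congr rfl (g := fun _ => (OmegaAH n m θ h A * gProj n θ).trace)
        (fun j hj => by rw [Function.update_of_ne (Finset.ne_of_mem_erase hj)])]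
      simp
    have hNc : (N : ℂ) + 1 ≠ 0 := by exact_mod_cast Nat.succ_ne_zero N
    have hacc : acceptProb n N (OmegaAH n m θ h A) (iidState n N θ) =
        ((OmegaAH n m θ h A * gProj n θ).trace ^ N).re := by
      rw [acceptProb]
      simp only [hterm, Finset.sum_const, Finset.card_univ, Fintype.card_fin, nsmul_eq_mul]
      push_cast
      rw [← mul_assoc, inv_mul_cancel₀ hNc, one_mul]
    rw [hacc]
    have ht : (OmegaAH n m θ h A * gProj n θ).trace =
        (((OmegaAH n m θ h A * gProj n θ).trace.re : ℝ) : ℂ) := by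
      apply Complex.ext
      · simp
      · have := (Complex.le_def.mp hT).2
        rw [Complex.ofReal_im] at this ⊢
        exact this.symm
    have hre := (Complex.le_def.mp hT).1
    rw [Complex.ofReal_re] at hre
    rw [ht, ← Complex.ofReal_pow, Complex.ofReal_re, mul_comm, pow_mul]
    exact pow_le_pow_left₀ (by positivity) hre N
  · intro ρ hρ ht hp
    set Om := OmegaAH n m θ h A with hOm
    set p := acceptProb n N Om ρ with hpdef
    set sn := Real.sin (Real.pi / (4 * h)) with hsn
    set q := (tens (fun _ : Fin (N + 1) => Om) * ρ).trace.re with hqdef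
    have hp0 : 0 < p := lt_of_lt_of_le hβ0 hp
    have hN1 : (0 : ℝ) < (N : ℝ) + 1 := by positivity
    have hsum : ∑ i : Fin (N + 1), (tens (Function.update (fun _ => Om) i 1) * ρ).trace.re =
        ((N : ℝ) + 1) * p := by
      rw [hpdef, acceptProb]
      simp only [testAll_eq]
      have : ((N : ℂ) + 1)⁻¹ = ((((N : ℝ) + 1)⁻¹ : ℝ) : ℂ) := by push_cast; rfl
      rw [this, Complex.re_ofReal_mul, ← mul_assoc, mul_inv_cancel₀ hN1.ne', one_mul,
        Complex.re_sum]
    have hop := op_ineq (ι := Fin (N + 1)) h0 h1 ρ hρ ht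
    rw [hsum, Fintype.card_fin] at hop
    push_cast at hop
    have hG := single_copy hm hsym h hh hA hdisj hcover hne
    rw [← hOm, ← hsn] at hG
    have hi : ∀ i : Fin (N + 1), (1 - m - n * sn) *
        (tens (Function.update (fun _ => Om) i 1) * ρ).trace.re + m * q ≤
        (tens (Function.update (fun _ => Om) i (gProj n θ)) * ρ).trace.re := by
      intro i
      have h2 := trace_psd_mul (tens_psd (Function.update (fun _ : Fin (N + 1) => Om) i _)
        (fun j => by
          by_cases hj : j = i
          · subst hj; rw [Function.update_self]; exact hG
          · rw [Function.update_of_ne hj]; exact h0)) hρ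
      rw [tens_update_add, ← neg_one_smul ℂ (_ + _ : QOp n), tens_update_smul, tens_update_add,
        tens_update_smul, tens_update_smul] at h2
      rw [Function.update_eq_self i (fun _ : Fin (N + 1) => Om)] at h2
      have hmc : (m : ℂ) = ((m : ℝ) : ℂ) := by push_cast; rfl
      simp only [Matrix.add_mul, Matrix.smul_mul, Matrix.trace_add, Matrix.trace_smul,
        smul_eq_mul, Complex.add_re, hmc, neg_one_mul, Complex.neg_re, Complex.re_ofReal_mul] at h2
      linarith
    have hcond : (star (gVec n θ) ⬝ᵥ (condState n N Om ρ *ᵥ gVec n θ)).re =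
        (((N : ℝ) + 1) * p)⁻¹ *
          ∑ i : Fin (N + 1), (tens (Function.update (fun _ => Om) i (gProj n θ)) * ρ).trace.re := by
      rw [quad_trace, condState, ← hpdef, Matrix.smul_mul, Matrix.trace_smul, smul_eq_mul,
        ← Complex.ofReal_inv, Complex.re_ofReal_mul, Matrix.sum_mul, Matrix.trace_sum,
        Complex.re_sum]
      congr 1
      refine Finset.sum_congr rfl fun i _ => ?_
      change (ptraceAt n N i (testAll n N Om i * ρ) * gProj n θ).trace.re = _
      rw [ptrace_trace, Matrix.trace_mul_comm, ← Matrix.mul_assoc, testAll_eq, tens_mul]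
      congr 4
      funext j
      by_cases hj : j = i
      · subst hj; simp
      · simp [hj]
    rw [hcond]
    have hS := Finset.sum_le_sum fun i (_ : i ∈ Finset.univ) => hi i
    rw [Finset.sum_add_distrib, ← Finset.mul_sum, hsum] at hS
    simp only [Finset.sum_const, Finset.card_univ, Fintype.card_fin, nsmul_eq_mul] at hS
    push_cast at hS
    set S := ∑ i : Fin (N + 1), (tens (Function.update (fun _ => Om) i (gProj n θ)) * ρ).trace.re
    have hlow : (1 - m - n * sn) + m * (q / p) ≤ (((N : ℝ) + 1) * p)⁻¹ * S := by
      rw [inv_mul_eq_div, le_div_iff₀ (by positivity)]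
      refine le_trans (le_of_eq ?_) hS
      field_simp
    refine le_trans ?_ hlow
    have hq2 : 1 - q / p ≤ (1 - p) / (p * N) := by
      rw [one_sub_div hp0.ne', div_le_div_iff₀ hp0 (by positivity)]
      have : (p - q) * N ≤ 1 - p := by linarith
      nlinarith [mul_le_mul_of_nonneg_right this hp0.le]
    have hmono : (1 - p) / (p * N) ≤ (1 - β) / (β * N) := by
      rw [div_le_div_iff₀ (by positivity) (by positivity)]
      nlinarith [mul_le_mul_of_nonneg_right hp hNp.le]
    have h5 := mul_le_mul_of_nonneg_left (hq2.trans hmono) hm'.le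
    rw [mul_div_assoc]
    linarith

end
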